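/- arXiv:1810.00185 — 2 statements merged into one kernel-verified Lean document; each statement's English description precedes it below -/
import Mathlib

section
/- For any d ≥ 2 and any positive integer k, the graph Λ(d,k) is connected: any two d-dimensional lattice polytopes contained in [0,k]^d can be transformed into one another by a finite sequence of insertions of lattice points and deletions of vertices, all intermediate polytopes being d-dimensional lattice polytopes contained in [0,k]^d. -/
open Set

/-- Points of `ℝ^d`. -/
abbrev Pt (d : ℕ) := Fin d → ℝ

/-- A polytope in `ℝ^d` is the convex hull of a finite set of points. -/
def IsPolytope (d : ℕ) (P : Set (Pt d)) : Prop :=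
  ∃ S : Finset (Pt d), P = convexHull ℝ (S : Set (Pt d))

/-- A set is `d`-dimensional (full-dimensional) if its affine hull is all of `ℝ^d`. -/
def FullDim (d : ℕ) (P : Set (Pt d)) : Prop := affineSpan ℝ P = ⊤

/-- A point `x` can be inserted in `P` when the convex hull of `P ∪ {x}` has as its
vertex set (set of extreme points) exactly the vertex set of `P` together with `x`. -/
def CanInsert (d : ℕ) (P : Set (Pt d)) (x : Pt d) : Prop :=
  Set.extremePoints ℝ (convexHull ℝ (P ∪ {x})) = Set.extremePoints ℝ P ∪ {x}

/-- A vertex `v` of `P` can be deleted from `P` when the convex hull of the remaining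
vertices is `d`-dimensional. -/
def CanDelete (d : ℕ) (P : Set (Pt d)) (v : Pt d) : Prop :=
  v ∈ Set.extremePoints ℝ P ∧
    FullDim d (convexHull ℝ (Set.extremePoints ℝ P \ {v}))

/-- `Q` is obtained from `P` by an insertion move. -/
def InsertMove (d : ℕ) (P Q : Set (Pt d)) : Prop :=
  ∃ x : Pt d, CanInsert d P x ∧ Q = convexHull ℝ (P ∪ {x})

/-- `Q` is obtained from `P` by a deletion move. -/
def DeleteMove (d : ℕ) (P Q : Set (Pt d)) : Prop :=
  ∃ v : Pt d, CanDelete d P v ∧ Q = convexHull ℝ (Set.extremePoints ℝ P \ {v})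

/-- Adjacency: one polytope is obtained from the other by inserting a point or
deleting a vertex. -/
def Move (d : ℕ) (P Q : Set (Pt d)) : Prop :=
  InsertMove d P Q ∨ DeleteMove d P Q ∨ InsertMove d Q P ∨ DeleteMove d Q P

/-- There is a path of at most `n` edges from `P` to `Q` all of whose vertices lie in
the class `C` of polytopes (i.e. `P` and `Q` are at distance at most `n` in the subgraph
induced by `C`). -/
def PathLE (d : ℕ) (C : Set (Set (Pt d))) (P Q : Set (Pt d)) (n : ℕ) : Prop :=
  ∃ (m : ℕ) (f : ℕ → Set (Pt d)), m ≤ n ∧ f 0 = P ∧ f m = Q ∧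
    (∀ i ≤ m, f i ∈ C) ∧ ∀ i < m, Move d (f i) (f (i + 1))

/-- The subgraph induced by the class `C` is connected. -/
def ConnectedIn (d : ℕ) (C : Set (Set (Pt d))) : Prop :=
  ∀ P ∈ C, ∀ Q ∈ C, ∃ n, PathLE d C P Q n

/-- The vertex set of the graph `Γ(d)`: the `d`-dimensional polytopes in `ℝ^d`. -/
def Gamma (d : ℕ) : Set (Set (Pt d)) := {P | IsPolytope d P ∧ FullDim d P}

/-- The number of vertices of a polytope. -/
noncomputable def nVerts (d : ℕ) (P : Set (Pt d)) : ℕ := (Set.extremePoints ℝ P).ncard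

/-- A lattice point of `ℝ^d`. -/
def IsLatticePt (d : ℕ) (x : Pt d) : Prop := ∀ i, ∃ z : ℤ, x i = (z : ℝ)

/-- A lattice polytope: all its vertices are lattice points. -/
def IsLatticePoly (d : ℕ) (P : Set (Pt d)) : Prop :=
  ∀ v ∈ Set.extremePoints ℝ P, IsLatticePt d v

/-- The hypercube `[0,k]^d`. -/
def Cube (d k : ℕ) : Set (Pt d) := {x | ∀ i, x i ∈ Set.Icc (0 : ℝ) (k : ℝ)}

/-- The vertex set of `Λ(d)`: the `d`-dimensional lattice polytopes in `ℝ^d`. -/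
def Lambda (d : ℕ) : Set (Set (Pt d)) :=
  {P | IsPolytope d P ∧ FullDim d P ∧ IsLatticePoly d P}

/-- The vertex set of `Λ(d,k)`: the `d`-dimensional lattice polytopes in `[0,k]^d`. -/
def LambdaK (d k : ℕ) : Set (Set (Pt d)) := {P ∈ Lambda d | P ⊆ Cube d k}

/-- A facet of a polytope `P`: an exposed face of dimension `d-1`. -/
def IsFacet (d : ℕ) (P F : Set (Pt d)) : Prop :=
  IsExposed ℝ P F ∧ F.Nonempty ∧ F ≠ P ∧
    Module.finrank ℝ ↥(vectorSpan ℝ F) = d - 1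

/-- `H` is the closed half-space `H_F^-(P)` bounded by the affine hull of the facet `F`
and satisfying `P ∩ H = F`. -/
def BoundingHalfspace (d : ℕ) (P F H : Set (Pt d)) : Prop :=
  ∃ (l : (Pt d) →ₗ[ℝ] ℝ) (c : ℝ), l ≠ 0 ∧
    H = {x | l x ≤ c} ∧
    (affineSpan ℝ F : Set (Pt d)) = {x | l x = c} ∧
    P ∩ H = F

/-- The cone `C_v(P)`: the intersection of the half-spaces `H_F^-(P)` over all facets
`F` of `P` incident to `v`. -/
def Cone (d : ℕ) (P : Set (Pt d)) (v : Pt d) : Set (Pt d) :=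
  {x | ∀ F H : Set (Pt d), IsFacet d P F → v ∈ F → BoundingHalfspace d P F H → x ∈ H}

/-- A set `A` is in convex position: every finite subset of `A` is the vertex set of
a polytope, namely of its own convex hull. -/
def ConvexPosition (d : ℕ) (A : Set (Pt d)) : Prop :=
  ∀ S : Finset (Pt d), (S : Set (Pt d)) ⊆ A →
    Set.extremePoints ℝ (convexHull ℝ (S : Set (Pt d))) = (S : Set (Pt d))

namespace LatticePolytope

variable {d k : ℕ}

/-- The lattice points of the hypercube `[0,k]^d`. -/
def cubeLattice (d k : ℕ) : Set (Pt d) := {x | IsLatticePt d x ∧ x ∈ Cube d k}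

/-- The point `v` together with its translates by the vectors `w l`. -/
def simplexVerts (v : Pt d) (w : Fin d → Pt d) : Set (Pt d) :=
  insert v (range fun l => v + w l)

/-- The points of `Z` are in (weak, pointwise) convex position. -/
def PointsExtreme (Z : Set (Pt d)) : Prop := ∀ z ∈ Z, z ∉ convexHull ℝ (Z \ {z})

/-- `P` and `Q` are joined by a path of moves through `Λ(d,k)`. -/
def Joined (d k : ℕ) : Set (Pt d) → Set (Pt d) → Prop :=
  Relation.ReflTransGen fun P Q => P ∈ LambdaK d k ∧ Q ∈ LambdaK d k ∧ Move d P Q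

theorem Joined.symm {P Q : Set (Pt d)} (h : Joined d k P Q) : Joined d k Q P :=
  have : Std.Symm fun P Q : Set (Pt d) => P ∈ LambdaK d k ∧ Q ∈ LambdaK d k ∧ Move d P Q :=
    ⟨by rintro P Q ⟨hP, hQ, hm⟩; exact ⟨hQ, hP, by unfold Move at *; tauto⟩⟩
  Relation.ReflTransGen.stdSymm.symm _ _ h

theorem Joined.exists_pathLE {P Q : Set (Pt d)} (hP : P ∈ LambdaK d k) (h : Joined d k P Q) :
    ∃ n, PathLE d (LambdaK d k) P Q n := by
  induction h with
  | refl => exact ⟨0, 0, fun _ => P, le_rfl, rfl, rfl, fun _ _ => hP, fun i hi => by omega⟩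
  | @tail Q R _ hQR ih =>
    obtain ⟨-, m, f, -, h0, hm, hC, hM⟩ := ih
    refine ⟨m + 1, m + 1, fun i => if i ≤ m then f i else R, le_rfl, by simpa using h0, by simp,
      fun i _ => ?_, fun i hi => ?_⟩
    · dsimp only
      split_ifs with h
      · exact hC i h
      · exact hQR.2.1
    · rcases Nat.lt_succ_iff_lt_or_eq.1 hi with h | rfl
      · simpa [h.le, Nat.succ_le_of_lt h] using hM i h
      · simpa [hm] using hQR.2.2

theorem PointsExtreme.mono {Y Z : Set (Pt d)} (hZ : PointsExtreme Z) (h : Y ⊆ Z) :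
    PointsExtreme Y := fun z hz hc =>
  hZ z (h hz) (convexHull_mono (sdiff_subset_sdiff_left h) hc)

theorem convexHull_extremePoints_of_finite {Z : Set (Pt d)} (hZ : Z.Finite) :
    convexHull ℝ (extremePoints ℝ (convexHull ℝ Z)) = convexHull ℝ Z := by
  have hfin : (extremePoints ℝ (convexHull ℝ Z)).Finite :=
    hZ.subset extremePoints_convexHull_subset
  rw [← (hfin.isClosed_convexHull ℝ).closure_eq]
  exact closure_convexHull_extremePoints (hZ.isCompact_convexHull ℝ) (convex_convexHull ℝ Z)

theorem PointsExtreme.extremePoints_convexHull {Z : Set (Pt d)} (hZ : PointsExtreme Z)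
    (hfin : Z.Finite) : extremePoints ℝ (convexHull ℝ Z) = Z := by
  refine extremePoints_convexHull_subset.antisymm fun z hz => ?_
  by_contra hn
  refine hZ z hz (convexHull_mono (subset_sdiff_singleton extremePoints_convexHull_subset hn) ?_)
  rw [convexHull_extremePoints_of_finite hfin]
  exact subset_convexHull ℝ Z hz

theorem pointsExtreme_extremePoints {P : Set (Pt d)} (hP : Convex ℝ P) :
    PointsExtreme (extremePoints ℝ P) := fun _ hz hc =>
  ((hP.mem_extremePoints_iff_mem_sdiff_convexHull_sdiff).1 hz).2
    (convexHull_mono (sdiff_subset_sdiff_left extremePoints_subset) hc)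

theorem convex_cube : Convex ℝ (Cube d k) := by
  have : Cube d k = Set.pi univ fun _ => Icc (0 : ℝ) k := by
    ext x; simp [Cube, Pi.le_def, forall_and]
  rw [this]
  exact convex_pi fun _ _ => convex_Icc _ _

theorem PointsExtreme.convexHull_mem {Z : Set (Pt d)} (hZ : PointsExtreme Z) (hfin : Z.Finite)
    (hL : Z ⊆ cubeLattice d k) (hs : affineSpan ℝ Z = ⊤) : convexHull ℝ Z ∈ LambdaK d k := by
  refine ⟨⟨⟨hfin.toFinset, by simp⟩, ?_, ?_⟩, convexHull_min (fun z hz => (hL hz).2) convex_cube⟩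
  · rw [FullDim, affineSpan_convexHull, hs]
  · intro z hz
    rw [hZ.extremePoints_convexHull hfin] at hz
    exact (hL hz).1

theorem PointsExtreme.joined_of_subset {Z Y : Set (Pt d)} (hZ : PointsExtreme Z) (hfin : Z.Finite)
    (hL : Z ⊆ cubeLattice d k) (hYZ : Y ⊆ Z) (hs : affineSpan ℝ Y = ⊤) :
    Joined d k (convexHull ℝ Z) (convexHull ℝ Y) := by
  induction h : Z.ncard generalizing Z with
  | zero =>
    obtain rfl : Z = ∅ := (ncard_eq_zero hfin).1 h
    rw [subset_empty_iff.1 hYZ]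
    exact Relation.ReflTransGen.refl
  | succ n ih =>
    rcases hYZ.eq_or_ssubset with rfl | hss
    · exact Relation.ReflTransGen.refl
    obtain ⟨x, hxZ, hxY⟩ := exists_of_ssubset hss
    have hY : Y ⊆ Z \ {x} := subset_sdiff_singleton hYZ hxY
    have hspan {T : Set (Pt d)} (hT : Y ⊆ T) : affineSpan ℝ T = ⊤ :=
      top_le_iff.1 (hs ▸ affineSpan_mono ℝ hT)
    have hZ' : PointsExtreme (Z \ {x}) := hZ.mono sdiff_subset
    have hext := hZ.extremePoints_convexHull hfin
    refine Relation.ReflTransGen.head ⟨hZ.convexHull_mem hfin hL (hspan hYZ),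
      hZ'.convexHull_mem hfin.sdiff (sdiff_subset.trans hL) (hspan hY), Or.inr (Or.inl
        ⟨x, ⟨hext.symm ▸ hxZ, ?_⟩, by rw [hext]⟩)⟩
      (ih hZ' hfin.sdiff (sdiff_subset.trans hL) hY ?_)
    · rw [hext, FullDim, affineSpan_convexHull, hspan hY]
    · rw [ncard_sdiff_singleton_of_mem hxZ, h]
      rfl

/-- A point with two positive and one negative barycentric coordinates with respect to an affinely
independent family is in convex position with that family. -/
theorem pointsExtreme_insert_range {ι : Type*} [DecidableEq ι] {p : ι → Pt d}
    {β : ι → Pt d →ᵃ[ℝ] ℝ} (hβ : ∀ i j, β i (p j) = if i = j then 1 else 0) {y : Pt d}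
    {i₁ i₂ i₃ : ι} (h₁₂ : i₁ ≠ i₂) (h₁ : 0 < β i₁ y) (h₂ : 0 < β i₂ y) (h₃ : β i₃ y < 0) :
    PointsExtreme (insert y (range p)) := by
  have key (f : Pt d →ᵃ[ℝ] ℝ) (z : Pt d) (T : Set (Pt d)) (hT : ∀ t ∈ T, f t < f z) :
      z ∉ convexHull ℝ T := fun hz =>
    lt_irrefl (f z) (convexHull_min (t := f ⁻¹' Iio (f z)) hT ((convex_Iio _).affine_preimage f) hz)
  rintro z (rfl | ⟨i, rfl⟩)
  · refine key (-β i₃) _ _ ?_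
    rintro t ⟨rfl | ⟨j, rfl⟩, hne⟩
    · exact absurd rfl hne
    · have : 0 ≤ β i₃ (p j) := by rw [hβ]; split_ifs <;> norm_num
      change -(β i₃ (p j)) < -(β i₃ _)
      linarith
  · obtain ⟨q, hqi, hq⟩ : ∃ q, q ≠ i ∧ 0 < β q y := by
      by_cases h : i₁ = i
      · exact ⟨i₂, fun h' => h₁₂ (h.trans h'.symm), h₂⟩
      · exact ⟨i₁, h, h₁⟩
    refine key (β i - (|β i y| / β q y) • β q) _ _ ?_
    rintro t ⟨rfl | ⟨j, rfl⟩, hne⟩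
    · have := le_abs_self (β i t)
      have h' : |β i t| / β q t * β q t = |β i t| := div_mul_cancel₀ _ hq.ne'
      simp [hβ, hqi, h']
      linarith
    · have hij : i ≠ j := by rintro rfl; exact hne rfl
      have : 0 ≤ |β i y| / β q y * (if q = j then 1 else 0) := by positivity
      simp [hβ, hqi, hij] at this ⊢
      split_ifs at this ⊢ <;> linarith

/-- `v` and the translates `v + w l` are the vertices of a full-dimensional simplex with vertices
in the lattice cube. -/
structure IsLatticeSimplex (k : ℕ) (v : Pt d) (w : Fin d → Pt d) : Prop where
  base_mem : v ∈ cubeLattice d k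
  add_mem : ∀ l, v + w l ∈ cubeLattice d k
  span_eq_top : Submodule.span ℝ (range w) = ⊤

/-- Barycentric coordinates of `v + ∑ l, g l • w l` in the simplex with vertices `v`, `v + w l`. -/
def baryCoord (g : Fin d → ℝ) (o : Option (Fin d)) : ℝ := o.elim (1 - ∑ l, g l) g

theorem affineSpan_simplexVerts {v : Pt d} {w : Fin d → Pt d}
    (h : Submodule.span ℝ (range w) = ⊤) : affineSpan ℝ (simplexVerts v w) = ⊤ := by
  rw [simplexVerts, AffineSubspace.affineSpan_eq_top_iff_vectorSpan_eq_top_of_nonempty ℝ _ _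
    (insert_nonempty _ _), vectorSpan_eq_span_vsub_set_right ℝ (mem_insert v _), ← top_le_iff, ← h]
  refine Submodule.span_mono ?_
  rintro _ ⟨l, rfl⟩
  exact ⟨v + w l, mem_insert_of_mem _ ⟨l, rfl⟩, by simp⟩

theorem simplexVerts_finite (v : Pt d) (w : Fin d → Pt d) : (simplexVerts v w).Finite :=
  (finite_range _).insert _

theorem IsLatticeSimplex.subset {v : Pt d} {w : Fin d → Pt d} (h : IsLatticeSimplex k v w) :
    simplexVerts v w ⊆ cubeLattice d k := by
  rintro _ (rfl | ⟨l, rfl⟩)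
  exacts [h.base_mem, h.add_mem l]

theorem linearIndependent_of_span_eq_top {w : Fin d → Pt d}
    (h : Submodule.span ℝ (range w) = ⊤) : LinearIndependent ℝ w :=
  linearIndependent_of_top_le_span_of_card_eq_finrank h.ge (by simp)

theorem pointsExtreme_insert_simplexVerts {v : Pt d} {w : Fin d → Pt d}
    (h : Submodule.span ℝ (range w) = ⊤) {g : Fin d → ℝ} {y : Pt d} (hy : y = ∑ l, g l • w l)
    {o₁ o₂ o₃ : Option (Fin d)} (h₁₂ : o₁ ≠ o₂) (h₁ : 0 < baryCoord g o₁)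
    (h₂ : 0 < baryCoord g o₂) (h₃ : baryCoord g o₃ < 0) :
    PointsExtreme (insert (v + y) (simplexVerts v w)) := by
  classical
  let b := Module.Basis.mk (linearIndependent_of_span_eq_top h) h.ge
  have hb (l m : Fin d) : b.coord l (w m) = if l = m then 1 else 0 := by
    rw [show w m = b m by simp [b], Module.Basis.coord_apply, Module.Basis.repr_self,
      Finsupp.single_apply]
    simp [eq_comm]
  let p : Option (Fin d) → Pt d := fun o => o.elim v fun l => v + w l
  let β : Option (Fin d) → Pt d →ᵃ[ℝ] ℝ := fun o => o.elim
    (AffineMap.const ℝ _ (1 + ∑ l, b.coord l v) - (∑ l, b.coord l).toAffineMap)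
    fun l => (b.coord l).toAffineMap - AffineMap.const ℝ _ (b.coord l v)
  have hp : simplexVerts v w = range p := by
    ext x
    simp [simplexVerts, p, Option.exists, eq_comm]
  have hβ (i j) : β i (p j) = if i = j then 1 else 0 := by
    rcases i with _ | i <;> rcases j with _ | j
    · simp [β, p]
    · simp [β, p, hb, -Module.Basis.coord_apply, Finset.sum_add_distrib]
      ring
    · simp [β, p]
    · simp [β, p, hb, -Module.Basis.coord_apply]
  have hβy (i) : β i (v + y) = baryCoord g i := by
    have hc (l) : b.coord l y = g l := by
      simp [hy, hb, -Module.Basis.coord_apply]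
    rcases i with _ | i
    · simp [β, baryCoord, hc, -Module.Basis.coord_apply, Finset.sum_add_distrib]
      ring
    · simp [β, baryCoord, hc, -Module.Basis.coord_apply]
  rw [hp]
  exact pointsExtreme_insert_range hβ h₁₂ ((hβy _).symm ▸ h₁) ((hβy _).symm ▸ h₂)
    ((hβy _).symm ▸ h₃)

theorem span_update_eq_top {w : Fin d → Pt d} (h : Submodule.span ℝ (range w) = ⊤)
    {g : Fin d → ℝ} {y : Pt d} (hy : y = ∑ l, g l • w l) {j : Fin d} (hj : g j ≠ 0) :
    Submodule.span ℝ (range (Function.update w j y)) = ⊤ := by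
  have hne {l} (hl : l ≠ j) : w l ∈ Submodule.span ℝ (range (Function.update w j y)) :=
    Submodule.subset_span ⟨l, by simp [hl]⟩
  rw [← top_le_iff, ← h, Submodule.span_le]
  rintro _ ⟨l, rfl⟩
  rcases ne_or_eq l j with hl | rfl
  · exact hne hl
  have : w l = (g l)⁻¹ • (y - ∑ m ∈ Finset.univ.erase l, g m • w m) := by
    rw [hy, ← Finset.add_sum_erase _ _ (Finset.mem_univ l), add_sub_cancel_right, smul_smul,
      inv_mul_cancel₀ hj, one_smul]
  rw [SetLike.mem_coe, this]
  refine Submodule.smul_mem _ _ (Submodule.sub_mem _ (Submodule.subset_span ⟨l, by simp⟩)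
    (Submodule.sum_mem _ fun m hm => Submodule.smul_mem _ _ (hne (Finset.ne_of_mem_erase hm))))

/-- The exchange move: insert `v + y` in a simplex, then delete the vertex `v + w j`. -/
theorem IsLatticeSimplex.exchange {v : Pt d} {w : Fin d → Pt d} (h : IsLatticeSimplex k v w)
    {y : Pt d} (hyL : v + y ∈ cubeLattice d k) {g : Fin d → ℝ} (hy : y = ∑ l, g l • w l)
    {j : Fin d} (hj : g j ≠ 0) {o₁ o₂ o₃ : Option (Fin d)} (h₁₂ : o₁ ≠ o₂)
    (h₁ : 0 < baryCoord g o₁) (h₂ : 0 < baryCoord g o₂) (h₃ : baryCoord g o₃ < 0) :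
    IsLatticeSimplex k v (Function.update w j y) ∧
      Joined d k (convexHull ℝ (simplexVerts v w))
        (convexHull ℝ (simplexVerts v (Function.update w j y))) := by
  have hspan := span_update_eq_top h.span_eq_top hy hj
  refine ⟨⟨h.base_mem, fun l => ?_, hspan⟩, ?_⟩
  · rcases ne_or_eq l j with hl | rfl
    · simpa [hl] using h.add_mem l
    · simpa using hyL
  have hZ := pointsExtreme_insert_simplexVerts (v := v) h.span_eq_top hy h₁₂ h₁ h₂ h₃
  have hfin := (simplexVerts_finite v w).insert (v + y)
  have hL := insert_subset hyL h.subset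
  refine (hZ.joined_of_subset hfin hL (subset_insert _ _)
    (affineSpan_simplexVerts h.span_eq_top)).symm.trans
    (hZ.joined_of_subset hfin hL ?_ (affineSpan_simplexVerts hspan))
  rintro _ (rfl | ⟨l, rfl⟩)
  · exact Or.inr (Or.inl rfl)
  · rcases ne_or_eq l j with hl | rfl
    · exact Or.inr (Or.inr ⟨l, by simp [hl]⟩)
    · exact Or.inl (by simp)

theorem add_single_mem_cubeLattice {v u : Pt d} (hv : v ∈ cubeLattice d k)
    (hu : v + u ∈ cubeLattice d k) {s : ℝ} (hs : s = 1 ∨ s = -1) {i : Fin d}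
    (hi : 0 < s * u i) : v + Pi.single i s ∈ cubeLattice d k := by
  have hsi : (∃ z : ℤ, v i + s = z) ∧ v i + s ∈ Icc (0 : ℝ) k := by
    obtain ⟨a, ha⟩ := hv.1 i
    obtain ⟨b, hb⟩ := hu.1 i
    have ha' := hv.2 i
    have hb' := hu.2 i
    rw [Pi.add_apply] at hb hb'
    obtain rfl | rfl := hs
    · have hab : a + 1 ≤ b := by
        have : (a : ℝ) < b := by linarith
        exact_mod_cast this
      have : (a : ℝ) + 1 ≤ b := by exact_mod_cast hab
      refine ⟨⟨a + 1, by push_cast; linarith⟩, ?_, ?_⟩ <;> linarith [ha'.1, hb'.2]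
    · have hab : b + 1 ≤ a := by
        have : (b : ℝ) < a := by linarith
        exact_mod_cast this
      have : (b : ℝ) + 1 ≤ a := by exact_mod_cast hab
      refine ⟨⟨a - 1, by push_cast; linarith⟩, ?_, ?_⟩ <;> linarith [ha'.2, hb'.1]
  constructor <;> intro m <;> rcases ne_or_eq m i with hm | rfl
  · simpa [hm] using hv.1 m
  · simpa using hsi.1
  · simpa [hm] using hv.2 m
  · simpa using hsi.2

/-- A sign such that moving `v` by it in direction `i` stays in the cube. -/
noncomputable def inwardSign (k : ℕ) (v : Pt d) (i : Fin d) : ℝ := if v i < k then 1 else -1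

theorem inwardSign_eq (k : ℕ) (v : Pt d) (i : Fin d) :
    inwardSign k v i = 1 ∨ inwardSign k v i = -1 := by
  unfold inwardSign; split_ifs <;> simp

theorem add_single_inwardSign_mem (hk : 1 ≤ k) {v : Pt d} (hv : v ∈ cubeLattice d k)
    (i : Fin d) : v + Pi.single i (inwardSign k v i) ∈ cubeLattice d k := by
  have hk' : (1 : ℝ) ≤ k := by exact_mod_cast hk
  refine add_single_mem_cubeLattice hv (u := Pi.single i (if v i < k then k - v i else - v i))
    ?_ (inwardSign_eq k v i) ?_
  · constructor <;> intro m <;> rcases ne_or_eq m i with hm | rfl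
    · simpa [hm] using hv.1 m
    · rw [Pi.add_apply, Pi.single_eq_same]
      split_ifs
      · exact ⟨k, by push_cast; ring⟩
      · exact ⟨0, by push_cast; ring⟩
    · simpa [hm] using hv.2 m
    · rw [Pi.add_apply, Pi.single_eq_same]
      split_ifs <;> constructor <;> linarith
  · have := (hv.2 i).2
    unfold inwardSign
    rw [Pi.single_eq_same]
    split_ifs <;> linarith

/-- An edge at `v` in a coordinate direction can be replaced by any unit edge of the same
direction that stays in the cube. -/
theorem IsLatticeSimplex.replace_axis {v : Pt d} {w : Fin d → Pt d} (h : IsLatticeSimplex k v w)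
    (hd : 2 ≤ d) (hk : 1 ≤ k) {i j : Fin d} {n s : ℝ} (hs : s = 1 ∨ s = -1)
    (hj : w j = Pi.single i n) (hv : v + Pi.single i s ∈ cubeLattice d k) :
    IsLatticeSimplex k v (Function.update w j (Pi.single i s)) ∧
      Joined d k (convexHull ℝ (simplexVerts v w))
        (convexHull ℝ (simplexVerts v (Function.update w j (Pi.single i s)))) := by
  have hn : n ≠ 0 := by
    rintro rfl
    exact (linearIndependent_of_span_eq_top h.span_eq_top).ne_zero j (by simp [hj])
  have : Nontrivial (Fin d) := Fin.nontrivial_iff_two_le.2 hd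
  obtain ⟨l, hl⟩ := exists_ne j
  obtain ⟨t, ht, htL⟩ : ∃ t : ℝ, (t = 1 ∨ t = -1) ∧
      v + w l + Pi.single i t ∈ cubeLattice d k :=
    ⟨_, inwardSign_eq k _ i, add_single_inwardSign_mem hk (h.add_mem l) i⟩
  have ht0 : t ≠ 0 := by rcases ht with rfl | rfl <;> norm_num
  have hs0 : s ≠ 0 := by rcases hs with rfl | rfl <;> norm_num
  have hsum (w : Fin d → Pt d) (a b : ℝ) :
      ∑ m, (Pi.single l a + Pi.single j b : Fin d → ℝ) m • w m = a • w l + b • w j := by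
    simp [add_smul, Finset.sum_add_distrib, Pi.single_apply, ite_smul]
  have hnone (a b : ℝ) : baryCoord (Pi.single l a + Pi.single j b) none = 1 - (a + b) := by
    simp [baryCoord, Finset.sum_add_distrib]
  have hcl (a b : ℝ) : baryCoord (Pi.single l a + Pi.single j b) (some l) = a := by
    simp [baryCoord, hl]
  have hcj (a b : ℝ) : baryCoord (Pi.single l a + Pi.single j b) (some j) = b := by
    simp [baryCoord, hl.symm]
  have hlj : some l ≠ some j := by simpa using hl
  set y : Pt d := w l + Pi.single i t with hy
  have hy' : y = ∑ m, (Pi.single l 1 + Pi.single j (t / n) : Fin d → ℝ) m • w m := by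
    rw [hsum, hj, one_smul, hy, ← Pi.single_smul', smul_eq_mul, div_mul_cancel₀ _ hn]
  have hyL : v + y ∈ cubeLattice d k := by rwa [hy, ← add_assoc]
  have hj0 : (Pi.single l 1 + Pi.single j (t / n) : Fin d → ℝ) j ≠ 0 := by
    simpa [hl.symm] using ⟨ht0, hn⟩
  have step₁ : IsLatticeSimplex k v (Function.update w j y) ∧
      Joined d k (convexHull ℝ (simplexVerts v w))
        (convexHull ℝ (simplexVerts v (Function.update w j y))) := by
    rcases lt_or_gt_of_ne (div_ne_zero ht0 hn) with hr | hr
    · exact h.exchange hyL hy' hj0 (o₁ := none) (o₂ := some l) (o₃ := some j) (by simp)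
        (by rw [hnone]; linarith) (by rw [hcl]; norm_num) (by rwa [hcj])
    · exact h.exchange hyL hy' hj0 (o₁ := some l) (o₂ := some j) (o₃ := none) hlj
        (by rw [hcl]; norm_num) (by rwa [hcj]) (by rw [hnone]; linarith)
  set w₁ := Function.update w j y with hw₁
  have hz' : Pi.single i s =
      ∑ m, (Pi.single l (-(s / t)) + Pi.single j (s / t) : Fin d → ℝ) m • w₁ m := by
    rw [hsum, hw₁, Function.update_of_ne hl, Function.update_self, hy, smul_add,
      ← Pi.single_smul', smul_eq_mul, div_mul_cancel₀ _ ht0]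
    module
  have hj1 : (Pi.single l (-(s / t)) + Pi.single j (s / t) : Fin d → ℝ) j ≠ 0 := by
    simpa [hl.symm] using ⟨hs0, ht0⟩
  have step₂ : IsLatticeSimplex k v (Function.update w₁ j (Pi.single i s)) ∧
      Joined d k (convexHull ℝ (simplexVerts v w₁))
        (convexHull ℝ (simplexVerts v (Function.update w₁ j (Pi.single i s)))) := by
    rcases lt_or_gt_of_ne (div_ne_zero hs0 ht0) with hr | hr
    · exact step₁.1.exchange hv hz' hj1 (o₁ := none) (o₂ := some l) (o₃ := some j) (by simp)
        (by rw [hnone]; linarith) (by rw [hcl]; linarith) (by rwa [hcj])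
    · exact step₁.1.exchange hv hz' hj1 (o₁ := none) (o₂ := some j) (o₃ := some l) (by simp)
        (by rw [hnone]; linarith) (by rwa [hcj]) (by rw [hcl]; linarith)
  rw [hw₁, Function.update_idem] at step₂
  exact ⟨step₂.1, step₁.2.trans step₂.2⟩

/-- The simplex `v, v + w l` is joined to one having an edge at `v` in direction `i`, without
altering the edges at `v` orthogonal to that direction. -/
def AxisReachable (k : ℕ) (v : Pt d) (i : Fin d) (w : Fin d → Pt d) : Prop :=
  ∃ w', IsLatticeSimplex k v w' ∧
    Joined d k (convexHull ℝ (simplexVerts v w)) (convexHull ℝ (simplexVerts v w')) ∧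
    (∀ l, w l i = 0 → w' l = w l) ∧ ∃ j n, w' j = Pi.single i n

theorem AxisReachable.of_update {v y : Pt d} {i j : Fin d} {w : Fin d → Pt d}
    (hj : w j i ≠ 0)
    (hJ : Joined d k (convexHull ℝ (simplexVerts v w))
      (convexHull ℝ (simplexVerts v (Function.update w j y))))
    (h : AxisReachable k v i (Function.update w j y)) : AxisReachable k v i w := by
  obtain ⟨w', hw', hJ', hfix, hax⟩ := h
  refine ⟨w', hw', hJ.trans hJ', fun l hl => ?_, hax⟩
  have hlj : l ≠ j := by rintro rfl; exact hj hl
  have := hfix l (by simpa [hlj] using hl)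
  simpa [hlj] using this

theorem sum_mul_apply_eq {w : Fin d → Pt d} {g : Fin d → ℝ} {i : Fin d} {s : ℝ}
    (hg : Pi.single i s = ∑ l, g l • w l) : ∑ l, g l * w l i = s := by
  have := congrFun hg i
  simpa using this.symm

/-- If `v + e` can be inserted, it can be exchanged for a vertex not orthogonal to `e`. -/
theorem IsLatticeSimplex.axisReachable_of_insert {v : Pt d} {w : Fin d → Pt d}
    (h : IsLatticeSimplex k v w) {i : Fin d} {s : ℝ} (hs : s ≠ 0)
    (hv : v + Pi.single i s ∈ cubeLattice d k) {g : Fin d → ℝ}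
    (hg : Pi.single i s = ∑ l, g l • w l) {o₁ o₂ o₃ : Option (Fin d)} (h₁₂ : o₁ ≠ o₂)
    (h₁ : 0 < baryCoord g o₁) (h₂ : 0 < baryCoord g o₂) (h₃ : baryCoord g o₃ < 0) :
    AxisReachable k v i w := by
  obtain ⟨j, -, hj⟩ := Finset.exists_ne_zero_of_sum_ne_zero ((sum_mul_apply_eq hg).trans_ne hs)
  obtain ⟨hgj, hwj⟩ := mul_ne_zero_iff.1 hj
  obtain ⟨h', hJ⟩ := h.exchange hv hg hgj h₁₂ h₁ h₂ h₃
  exact AxisReachable.of_update hwj hJ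
    ⟨_, h', Relation.ReflTransGen.refl, fun _ _ => rfl, j, s, by simp⟩

theorem single_eq_sum_update {w : Fin d → Pt d} {g : Fin d → ℝ} {i p : Fin d} {s : ℝ}
    (hg : Pi.single i s = ∑ l, g l • w l) (hp : 1 - g p ≠ 0) :
    Pi.single i s =
      ∑ l, (g l / (1 - g p)) • Function.update w p (w p - Pi.single i s) l := by
  have h : ∑ l, g l • Function.update w p (w p - Pi.single i s) l
      = (1 - g p) • (Pi.single i s : Pt d) := by
    have : ∀ l, g l • Function.update w p (w p - Pi.single i s) l
        = g l • w l - if l = p then g p • (Pi.single i s : Pt d) else 0 := by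
      intro l
      rcases ne_or_eq l p with hl | rfl
      · simp [hl]
      · simp [smul_sub]
    rw [Finset.sum_congr rfl fun l _ => this l, Finset.sum_sub_distrib, ← hg]
    simp [sub_smul]
  calc (Pi.single i s : Pt d) = (1 - g p)⁻¹ • ((1 - g p) • (Pi.single i s : Pt d)) := by
        rw [smul_smul, inv_mul_cancel₀ hp, one_smul]
    _ = _ := by
        rw [← h, Finset.smul_sum]
        refine Finset.sum_congr rfl fun l _ => ?_
        rw [smul_smul, div_eq_inv_mul]

theorem sum_mul_mul_apply_eq_one {w : Fin d → Pt d} {g : Fin d → ℝ} {i : Fin d} {s : ℝ}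
    (hs : s = 1 ∨ s = -1) (hg : Pi.single i s = ∑ l, g l • w l) :
    ∑ l, g l * (s * w l i) = 1 := by
  have hss : s * s = 1 := by rcases hs with rfl | rfl <;> norm_num
  calc ∑ l, g l * (s * w l i) = s * ∑ l, g l * w l i := by
        rw [Finset.mul_sum]
        exact Finset.sum_congr rfl fun l _ => by ring
    _ = 1 := by rw [sum_mul_apply_eq hg, hss]

theorem single_sub_sum {w : Fin d → Pt d} {g : Fin d → ℝ} {i : Fin d} {s : ℝ}
    (hg : Pi.single i s = ∑ l, g l • w l) (p : Fin d) :
    w p - Pi.single i s = ∑ l, (Pi.single p 1 - g : Fin d → ℝ) l • w l := by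
  rw [hg]
  simp [sub_smul, Finset.sum_sub_distrib, Pi.single_apply, ite_smul]

theorem baryCoord_single_sub (g : Fin d → ℝ) (p : Fin d) :
    baryCoord (Pi.single p 1 - g) none = ∑ l, g l := by
  simp [baryCoord, Finset.sum_sub_distrib]

theorem baryCoord_none (g : Fin d → ℝ) : baryCoord g none = 1 - ∑ l, g l := rfl

theorem neg_eq_one_or {s : ℝ} (hs : s = 1 ∨ s = -1) : -s = 1 ∨ -s = -1 := by
  rcases hs with rfl | rfl <;> simp

theorem IsLatticeSimplex.add_sub_single_mem {v : Pt d} {w : Fin d → Pt d}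
    (h : IsLatticeSimplex k v w) {i p : Fin d} {s : ℝ} (hs : s = 1 ∨ s = -1)
    (hp : 0 < s * w p i) : v + (w p - Pi.single i s) ∈ cubeLattice d k := by
  have := add_single_mem_cubeLattice (h.add_mem p) (u := -w p) (by simpa using h.base_mem)
    (neg_eq_one_or hs) (i := i) (by simpa using hp)
  rwa [Pi.single_neg, add_assoc, ← sub_eq_add_neg] at this

theorem IsLatticeSimplex.one_le_mul {v : Pt d} {w : Fin d → Pt d}
    (h : IsLatticeSimplex k v w) {i p : Fin d} {s : ℝ} (hs : s = 1 ∨ s = -1)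
    (hp : 0 < s * w p i) : 1 ≤ s * w p i := by
  obtain ⟨a, ha⟩ := h.base_mem.1 i
  obtain ⟨b, hb⟩ := (h.add_mem p).1 i
  have hw : w p i = ((b - a : ℤ) : ℝ) := by
    rw [Pi.add_apply] at hb
    push_cast
    linarith
  rw [hw] at hp ⊢
  rcases hs with rfl | rfl
  · rw [one_mul] at hp ⊢
    exact_mod_cast (Int.cast_pos.1 hp : 0 < b - a)
  · rw [neg_one_mul, ← Int.cast_neg] at hp ⊢
    exact_mod_cast (Int.cast_pos.1 hp : 0 < -(b - a))

/-- The case where the direction `e` lies in the cone spanned by the edges at `v`. -/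
theorem IsLatticeSimplex.axisReachable_of_nonneg (N : ℕ) {v : Pt d} {i : Fin d} {s : ℝ}
    (hs : s = 1 ∨ s = -1) (hv : v + Pi.single i s ∈ cubeLattice d k) {w : Fin d → Pt d}
    (h : IsLatticeSimplex k v w) (hN : ∑ l, |w l i| ≤ N) {g : Fin d → ℝ}
    (hg0 : ∀ l, 0 ≤ g l) (hg : Pi.single i s = ∑ l, g l • w l) : AxisReachable k v i w := by
  have hs0 : s ≠ 0 := by rcases hs with rfl | rfl <;> norm_num
  induction N generalizing w g with
  | zero =>
    have hz : ∀ l, w l i = 0 := fun l => abs_eq_zero.1 <|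
      (Finset.sum_eq_zero_iff_of_nonneg fun l _ => abs_nonneg _).1
        (le_antisymm (by simpa using hN) (Finset.sum_nonneg fun l _ => abs_nonneg _)) l
        (Finset.mem_univ l)
    exact absurd (sum_mul_apply_eq hg).symm (by simpa [hz] using hs0)
  | succ N ih =>
    have hsum := sum_mul_mul_apply_eq_one hs hg
    obtain ⟨p, -, hp⟩ := Finset.exists_lt_of_sum_lt (s := Finset.univ) (f := fun _ : Fin d => (0 : ℝ))
      (g := fun l => g l * (s * w l i)) (by rw [hsum]; simp)
    have hgp : 0 < g p := (hg0 p).lt_of_ne fun h0 => by simp [← h0] at hp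
    have hwp : 0 < s * w p i := pos_of_mul_pos_right hp hgp.le
    have hwp0 : w p i ≠ 0 := fun h0 => by simp [h0] at hwp
    by_cases hq : ∀ q, q ≠ p → g q = 0
    · have : Pi.single i s = g p • w p := by
        rw [hg, Finset.sum_eq_single p (fun q _ hqp => by rw [hq q hqp, zero_smul]) (by simp)]
      refine ⟨w, h, Relation.ReflTransGen.refl, fun _ _ => rfl, p, (g p)⁻¹ * s, ?_⟩
      rw [← smul_eq_mul, Pi.single_smul', this, smul_smul, inv_mul_cancel₀ hgp.ne', one_smul]
    push Not at hq
    obtain ⟨q, hqp, hgq⟩ := hq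
    have hgq : 0 < g q := (hg0 q).lt_of_ne hgq.symm
    have hpq : g p + g q ≤ ∑ l, g l := by
      rw [← Finset.sum_pair hqp.symm]
      exact Finset.sum_le_univ_sum_of_nonneg hg0
    have hpq' : some p ≠ some q := by simpa using hqp.symm
    by_cases h1 : 1 < ∑ l, g l
    · exact h.axisReachable_of_insert hs0 hv hg hpq' hgp hgq (o₃ := none)
        (by rw [baryCoord_none]; linarith)
    have hp1 : 0 < 1 - g p := by linarith
    obtain ⟨h', hJ⟩ := h.exchange (h.add_sub_single_mem hs hwp) (single_sub_sum hg p) (j := p)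
      (by simpa using hp1.ne') (o₁ := none) (o₂ := some p) (o₃ := some q) (by simp)
      (by rw [baryCoord_single_sub]; linarith) (by simpa [baryCoord] using hp1)
      (by simpa [baryCoord, hqp] using hgq)
    refine AxisReachable.of_update hwp0 hJ (ih h' ?_ (fun l => div_nonneg (hg0 l) hp1.le)
      (single_eq_sum_update hg hp1.ne'))
    have h1p := h.one_le_mul hs hwp
    have habs : |w p i - s| = |w p i| - 1 := by
      rcases hs with rfl | rfl
      · rw [one_mul] at h1p
        rw [abs_of_nonneg (by linarith), abs_of_nonneg (by linarith)]
      · rw [abs_of_nonpos (by linarith), abs_of_nonpos (by linarith)]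
        ring
    rw [← Finset.add_sum_erase _ _ (Finset.mem_univ p)] at hN ⊢
    rw [Finset.sum_congr rfl fun l hl => by
      rw [Function.update_of_ne (Finset.ne_of_mem_erase hl)], Function.update_self,
      Pi.sub_apply, Pi.single_eq_same, habs]
    push_cast at hN
    linarith

theorem IsLatticeSimplex.axisReachable {v : Pt d} {i : Fin d} {s : ℝ}
    (hs : s = 1 ∨ s = -1) (hv : v + Pi.single i s ∈ cubeLattice d k) {w : Fin d → Pt d}
    (h : IsLatticeSimplex k v w) : AxisReachable k v i w := by
  have hs0 : s ≠ 0 := by rcases hs with rfl | rfl <;> norm_num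
  obtain ⟨g, hg⟩ := (Submodule.mem_span_range_iff_exists_fun ℝ).1
    (h.span_eq_top ▸ Submodule.mem_top : (Pi.single i s : Pt d) ∈ Submodule.span ℝ (range w))
  replace hg := hg.symm
  obtain ⟨N, hN⟩ := exists_nat_ge (∑ l, |w l i|)
  have hsum := sum_mul_mul_apply_eq_one hs hg
  obtain ⟨l, -, hl⟩ := Finset.exists_lt_of_sum_lt (s := Finset.univ) (f := fun _ : Fin d => (0 : ℝ))
    (g := fun l => g l * (s * w l i)) (by rw [hsum]; simp)
  have hneg : Pi.single i (-s) = ∑ l, (-g l) • w l := by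
    simp [Pi.single_neg, hg, neg_smul, Finset.sum_neg_distrib]
  have hvneg (hl : s * w l i < 0) : v + Pi.single i (-s) ∈ cubeLattice d k :=
    add_single_mem_cubeLattice h.base_mem (h.add_mem l) (neg_eq_one_or hs) (by linarith)
  by_cases hpos : ∀ l, 0 ≤ g l
  · exact axisReachable_of_nonneg N hs hv h hN hpos hg
  push Not at hpos
  obtain ⟨q, hq⟩ := hpos
  by_cases hnp : ∀ l, g l ≤ 0
  · have hwl : s * w l i < 0 := by
      by_contra! hc
      linarith [mul_nonpos_of_nonpos_of_nonneg (hnp l) hc]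
    exact axisReachable_of_nonneg N (neg_eq_one_or hs) (hvneg hwl) h hN
      (fun l => neg_nonneg.2 (hnp l)) hneg
  push Not at hnp
  obtain ⟨p, hp⟩ := hnp
  by_cases h1 : ∑ l, g l < 1
  · exact h.axisReachable_of_insert hs0 hv hg (o₁ := none) (o₂ := some p) (o₃ := some q) (by simp)
      (by rw [baryCoord_none]; linarith) hp hq
  by_cases huniq : ∃ p', p' ≠ p ∧ 0 < g p'
  · obtain ⟨p', hp'p, hp'⟩ := huniq
    exact h.axisReachable_of_insert hs0 hv hg (o₁ := some p') (o₂ := some p) (o₃ := some q)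
      (by simpa using hp'p) hp' hp hq
  push Not at h1 huniq
  rcases lt_or_gt_of_ne (right_ne_zero_of_mul hl.ne') with hwl | hwl
  · exact h.axisReachable_of_insert (neg_ne_zero.2 hs0) (hvneg hwl) hneg (o₁ := none)
      (o₂ := some q) (o₃ := some p) (by simp)
      (by rw [baryCoord_none, Finset.sum_neg_distrib]; linarith)
      (by simpa [baryCoord] using hq) (by simpa [baryCoord] using hp)
  obtain rfl : l = p := by
    by_contra hne
    linarith [mul_nonpos_of_nonpos_of_nonneg (huniq l hne) hwl.le]
  have hql : q ≠ l := by rintro rfl; linarith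
  have hl1 : 1 - g l < 0 := by
    have hrest : ∑ m ∈ (Finset.univ.erase l).erase q, g m ≤ 0 := Finset.sum_nonpos fun m hm =>
      huniq m (Finset.ne_of_mem_erase (Finset.mem_of_mem_erase hm))
    rw [← Finset.add_sum_erase _ _ (Finset.mem_univ l),
      ← Finset.add_sum_erase _ _ (Finset.mem_erase.2 ⟨hql, Finset.mem_univ q⟩)] at h1
    linarith
  obtain ⟨h', hJ⟩ := h.exchange (h.add_sub_single_mem hs hwl) (single_sub_sum hg l) (j := l)
    (by simpa using hl1.ne) (o₁ := none) (o₂ := some q) (o₃ := some l) (by simp)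
    (by rw [baryCoord_single_sub]; linarith) (by simpa [baryCoord, hql] using hq)
    (by simpa [baryCoord] using hl1)
  refine AxisReachable.of_update (fun h0 => by simp [h0] at hwl) hJ
    (h'.axisReachable_of_insert hs0 hv (single_eq_sum_update hg hl1.ne) (o₁ := none)
      (o₂ := some q) (o₃ := some l) (by simp) ?_ (div_pos_of_neg_of_neg hq hl1)
      (div_neg_of_pos_of_neg hp hl1))
  rw [baryCoord_none, ← Finset.sum_div]
  linarith [div_neg_of_pos_of_neg (by linarith : 0 < ∑ l, g l) hl1]

theorem IsLatticeSimplex.exists_axes (hd : 2 ≤ d) (hk : 1 ≤ k) {v : Pt d} {w : Fin d → Pt d}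
    (h : IsLatticeSimplex k v w) (A : Finset (Fin d)) :
    ∃ w', IsLatticeSimplex k v w' ∧
      Joined d k (convexHull ℝ (simplexVerts v w)) (convexHull ℝ (simplexVerts v w')) ∧
      ∀ i ∈ A, ∃ j, w' j = Pi.single i (inwardSign k v i) := by
  induction A using Finset.induction_on with
  | empty => exact ⟨w, h, Relation.ReflTransGen.refl, by simp⟩
  | insert i A hi ih =>
    obtain ⟨w₁, h₁, hJ₁, hA⟩ := ih
    have hs := inwardSign_eq k v i
    have hv := add_single_inwardSign_mem hk h.base_mem i
    obtain ⟨w₂, h₂, hJ₂, hfix, j, n, hj⟩ := h₁.axisReachable hs hv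
    obtain ⟨h₃, hJ₃⟩ := h₂.replace_axis hd hk hs hj hv
    refine ⟨_, h₃, hJ₁.trans (hJ₂.trans hJ₃), fun m hm => ?_⟩
    rcases Finset.mem_insert.1 hm with rfl | hm
    · exact ⟨j, by simp⟩
    obtain ⟨l, hl⟩ := hA m hm
    have hmi : i ≠ m := by rintro rfl; exact hi hm
    have hl₂ := hfix l (by simp [hl, hmi])
    have hlj : l ≠ j := by
      rintro rfl
      have hzero := congrFun (hj.symm.trans (hl₂.trans hl)) i
      rw [Pi.single_eq_same, Pi.single_eq_of_ne hmi] at hzero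
      refine (linearIndependent_of_span_eq_top h₂.span_eq_top).ne_zero l ?_
      rw [hj, hzero, Pi.single_zero]
    exact ⟨l, by rw [Function.update_of_ne hlj, hl₂, hl]⟩

/-- The edges of the unit corner simplex at `v`. -/
noncomputable def cornerEdges (k : ℕ) (v : Pt d) (i : Fin d) : Pt d :=
  Pi.single i (inwardSign k v i)

theorem inwardSign_ne_zero (k : ℕ) (v : Pt d) (i : Fin d) : inwardSign k v i ≠ 0 := by
  rcases inwardSign_eq k v i with h | h <;> rw [h] <;> norm_num

theorem eq_sum_cornerEdges (k : ℕ) (v x : Pt d) :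
    x = ∑ i, (x i / inwardSign k v i) • cornerEdges k v i := by
  ext m
  simp [cornerEdges, Pi.single_apply, inwardSign_ne_zero]

theorem isLatticeSimplex_cornerEdges (hk : 1 ≤ k) {v : Pt d} (hv : v ∈ cubeLattice d k) :
    IsLatticeSimplex k v (cornerEdges k v) where
  base_mem := hv
  add_mem := add_single_inwardSign_mem hk hv
  span_eq_top := top_le_iff.1 fun x _ =>
    (Submodule.mem_span_range_iff_exists_fun ℝ).2 ⟨_, (eq_sum_cornerEdges k v x).symm⟩

theorem IsLatticeSimplex.joined_corner (hd : 2 ≤ d) (hk : 1 ≤ k) {v : Pt d} {w : Fin d → Pt d}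
    (h : IsLatticeSimplex k v w) :
    Joined d k (convexHull ℝ (simplexVerts v w))
      (convexHull ℝ (simplexVerts v (cornerEdges k v))) := by
  obtain ⟨w', -, hJ, hA⟩ := h.exists_axes hd hk Finset.univ
  choose j hj using fun i => hA i (Finset.mem_univ i)
  have hinj : Function.Injective j := fun a b hab => by
    by_contra hne
    have := congrFun ((hj a).symm.trans ((congrArg w' hab).trans (hj b))) a
    rw [Pi.single_eq_same, Pi.single_eq_of_ne hne] at this
    exact inwardSign_ne_zero k v a this
  have hrange : simplexVerts v w' = simplexVerts v (cornerEdges k v) := by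
    unfold simplexVerts
    rw [← (Finite.injective_iff_surjective.1 hinj).range_comp]
    congr 2
    ext i : 1
    simp [cornerEdges, hj]
  rwa [hrange] at hJ

theorem exists_joined_simplex {P : Set (Pt d)} (hP : P ∈ LambdaK d k) {v : Pt d}
    (hv : v ∈ extremePoints ℝ P) :
    ∃ w, IsLatticeSimplex k v w ∧ Joined d k P (convexHull ℝ (simplexVerts v w)) := by
  obtain ⟨⟨⟨S, hS⟩, hfull, hlat⟩, hcube⟩ := hP
  have hconv : Convex ℝ P := hS ▸ convex_convexHull ℝ _
  have hfin : (extremePoints ℝ P).Finite :=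
    S.finite_toSet.subset (hS ▸ extremePoints_convexHull_subset)
  have hhull : convexHull ℝ (extremePoints ℝ P) = P := by
    rw [hS, convexHull_extremePoints_of_finite S.finite_toSet]
  have hL : extremePoints ℝ P ⊆ cubeLattice d k := fun x hx =>
    ⟨hlat x hx, hcube (extremePoints_subset hx)⟩
  have hspan : Submodule.span ℝ (range fun x : extremePoints ℝ P => (x : Pt d) - v) = ⊤ := by
    rw [FullDim, ← hhull, affineSpan_convexHull,
      AffineSubspace.affineSpan_eq_top_iff_vectorSpan_eq_top_of_nonempty ℝ _ _ ⟨v, hv⟩,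
      vectorSpan_eq_span_vsub_set_right ℝ hv] at hfull
    rw [← hfull]
    congr 1
    ext x
    simp
  obtain ⟨κ, a, -, ha, hli⟩ := exists_linearIndependent' ℝ
    fun x : extremePoints ℝ P => (x : Pt d) - v
  let b := Module.Basis.mk hli (by rw [ha, hspan])
  have : Fintype κ := Module.Basis.fintypeIndexOfRankLtAleph0 b (Module.rank_lt_aleph0 ℝ _)
  let e : κ ≃ Fin d := Fintype.equivFinOfCardEq (by
    rw [← Module.finrank_eq_card_basis b]; simp)
  let w : Fin d → Pt d := fun l => (a (e.symm l) : Pt d) - v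
  have hw : Submodule.span ℝ (range w) = ⊤ := by
    rw [← hspan, ← ha, ← e.symm.surjective.range_comp]
    rfl
  have hsub : simplexVerts v w ⊆ extremePoints ℝ P := by
    rintro _ (rfl | ⟨l, rfl⟩)
    · exact hv
    · simp [w]
  refine ⟨w, ⟨hL hv, fun l => hL (hsub (Or.inr ⟨l, rfl⟩)), hw⟩, ?_⟩
  have := (pointsExtreme_extremePoints hconv).joined_of_subset hfin hL hsub
    (affineSpan_simplexVerts hw)
  rwa [hhull] at this

theorem joined_corner (hd : 2 ≤ d) (hk : 1 ≤ k) {P : Set (Pt d)} (hP : P ∈ LambdaK d k)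
    {v : Pt d} (hv : v ∈ extremePoints ℝ P) :
    Joined d k P (convexHull ℝ (simplexVerts v (cornerEdges k v))) := by
  obtain ⟨w, hw, hJ⟩ := exists_joined_simplex hP hv
  exact hJ.trans (hw.joined_corner hd hk)

/-- The vertices of a simplex are in convex position. -/
theorem pointsExtreme_simplexVerts (hd : 2 ≤ d) {v : Pt d} {w : Fin d → Pt d}
    (h : Submodule.span ℝ (range w) = ⊤) : PointsExtreme (simplexVerts v w) := by
  have : Nontrivial (Fin d) := Fin.nontrivial_iff_two_le.2 hd
  obtain ⟨j, l, hjl⟩ := exists_pair_ne (Fin d)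
  refine (pointsExtreme_insert_simplexVerts (v := v) h
    (g := Pi.single l 1 - Pi.single j 1) rfl (o₁ := none) (o₂ := some l) (o₃ := some j)
    ?_ ?_ ?_ ?_).mono (subset_insert _ _)
  all_goals simp [baryCoord, hjl, hjl.symm]

theorem joined_corners (hd : 2 ≤ d) (hk : 1 ≤ k) {v v' : Pt d} (hv : v ∈ cubeLattice d k)
    (hv' : v' ∈ cubeLattice d k) :
    Joined d k (convexHull ℝ (simplexVerts v (cornerEdges k v)))
      (convexHull ℝ (simplexVerts v' (cornerEdges k v'))) := by
  by_cases heq : v = v'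
  · subst heq; exact Relation.ReflTransGen.refl
  obtain ⟨i, hi⟩ := Function.ne_iff.1 heq
  have hc := isLatticeSimplex_cornerEdges hk hv
  set w := Function.update (cornerEdges k v) i (v' - v) with hw
  have hspan : Submodule.span ℝ (range w) = ⊤ :=
    span_update_eq_top hc.span_eq_top (eq_sum_cornerEdges k v (v' - v))
      (div_ne_zero (sub_ne_zero.2 hi.symm) (inwardSign_ne_zero k v i))
  have hsimp : IsLatticeSimplex k v w := by
    refine ⟨hv, fun l => ?_, hspan⟩
    rcases ne_or_eq l i with hl | rfl
    · simpa [hw, hl] using hc.add_mem l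
    · simpa [hw] using hv'
  have hZ := pointsExtreme_simplexVerts hd hspan (v := v)
  have hfin := simplexVerts_finite v w
  have hext := hZ.extremePoints_convexHull hfin
  have hP := hZ.convexHull_mem hfin hsimp.subset (affineSpan_simplexVerts hspan)
  refine (joined_corner hd hk hP ?_).symm.trans (joined_corner hd hk hP ?_) <;> rw [hext]
  · exact mem_insert _ _
  · exact Or.inr ⟨i, by simp [hw]⟩

theorem exists_vertex {P : Set (Pt d)} (hP : P ∈ LambdaK d k) :
    ∃ v ∈ extremePoints ℝ P, v ∈ cubeLattice d k := by
  obtain ⟨⟨⟨S, hS⟩, hfull, hlat⟩, hcube⟩ := hP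
  have hne : P.Nonempty := by
    rw [← affineSpan_nonempty (k := ℝ), show affineSpan ℝ P = ⊤ from hfull]
    exact ⟨0, trivial⟩
  have hcomp : IsCompact P := hS ▸ S.finite_toSet.isCompact_convexHull ℝ
  obtain ⟨v, hv⟩ := hcomp.extremePoints_nonempty hne
  exact ⟨v, hv, hlat v hv, hcube (extremePoints_subset hv)⟩

end LatticePolytope

/-- the graph `Λ(d,k)` is connected. -/
theorem stmt_12 (d k : ℕ) (hd : 2 ≤ d) (hk : 1 ≤ k) :
    ConnectedIn d (LambdaK d k) := by
  intro P hP Q hQ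
  obtain ⟨v, hv, hvL⟩ := LatticePolytope.exists_vertex hP
  obtain ⟨v', hv', hvL'⟩ := LatticePolytope.exists_vertex hQ
  exact LatticePolytope.Joined.exists_pathLE hP
    ((LatticePolytope.joined_corner hd hk hP hv).trans
      ((LatticePolytope.joined_corners hd hk hvL hvL').trans
        (LatticePolytope.joined_corner hd hk hQ hv').symm))
end

section
/- For any d ≥ 2, the graph Λ(d) is connected, and moreover the subgraph induced in Λ(d) by the d-dimensional lattice simplices (lattice polytopes with exactly d+1 vertices) and the d-dimensional lattice polytopes with exactly d+2 vertices is connected. -/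
open Set

section AffineCoordinates

variable {E : Type*} [AddCommGroup E] [Module ℝ E]

lemma AffineMap.apply_add_smul_sub (g : E →ᵃ[ℝ] ℝ) (v a b : E) (t : ℝ) :
    g (v + t • (a - b)) = g v + t * (g a - g b) := by
  rw [g.decomp]
  simp only [Pi.add_apply, map_add, map_smul, map_sub, smul_eq_mul]
  ring

lemma AffineMap.apply_add_sub (g : E →ᵃ[ℝ] ℝ) (a b v : E) :
    g (a + b - v) = g a + g b - g v := by
  rw [g.decomp]
  simp only [Pi.add_apply, map_add, map_sub]
  ring

/-- The affine functionals `c a`, for `a ∈ A`, are dual to the points of `A`; they are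
barycentric coordinates when `A` spans the space. -/
structure DualOn (A : Finset E) (c : E → E →ᵃ[ℝ] ℝ) : Prop where
  apply_self : ∀ a ∈ A, c a a = 1
  apply_ne : ∀ a ∈ A, ∀ b ∈ A, b ≠ a → c a b = 0

namespace DualOn

variable {A : Finset E} {c : E → E →ᵃ[ℝ] ℝ}

lemma affineIndependent (h : DualOn A c) : AffineIndependent ℝ ((↑) : A → E) := by
  rw [affineIndependent_iff]
  intro s w hw hsum a ha
  have key : (c a).linear (∑ e ∈ s, w e • (e : E)) = ∑ e ∈ s, w e * (c a e - c a 0) := by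
    rw [map_sum]
    refine Finset.sum_congr rfl fun e _ => ?_
    have hdecomp : c a e = (c a).linear e + c a 0 := congrFun (c a).decomp (e : E)
    rw [map_smul, smul_eq_mul, hdecomp, add_sub_cancel_right]
  rw [hsum, map_zero] at key
  simp only [mul_sub, Finset.sum_sub_distrib, ← Finset.sum_mul, hw, zero_mul, sub_zero] at key
  rw [Finset.sum_eq_single_of_mem a ha, h.apply_self a a.2, mul_one] at key
  · exact key.symm
  · intro b _ hb
    rw [h.apply_ne a a.2 b b.2 (fun e => hb (Subtype.ext e)), mul_zero]

lemma apply_eq_sum (h : DualOn A c) (hA : affineSpan ℝ (A : Set E) = ⊤)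
    (g : E →ᵃ[ℝ] ℝ) (x : E) : g x = ∑ a ∈ A, g a * c a x := by
  have hsum : ∀ (s : Finset E) (y : E), (∑ a ∈ s, g a • c a) y = ∑ a ∈ s, g a * c a y := by
    intro s y
    induction s using Finset.cons_induction with
    | empty => rfl
    | cons a s ha ih =>
      rw [Finset.sum_cons, Finset.sum_cons, AffineMap.coe_add, Pi.add_apply, ih,
        AffineMap.coe_smul, Pi.smul_apply, smul_eq_mul]
  have hg : g = ∑ a ∈ A, g a • c a := by
    refine AffineMap.ext_on hA fun b hb => ?_
    rw [hsum, Finset.sum_eq_single_of_mem b hb, h.apply_self b hb, mul_one]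
    intro a ha hab
    rw [h.apply_ne a ha b hb hab.symm, mul_zero]
  exact (congrArg (fun f : E →ᵃ[ℝ] ℝ => f x) hg).trans (hsum A x)

variable [DecidableEq E]

lemma notMem_erase (h : DualOn A c) {v w : E} (hv : v ∈ A) (hw : c v w ≠ 0) :
    w ∉ A.erase v := fun hwA =>
  hw (h.apply_ne v hv w (Finset.mem_of_mem_erase hwA) (Finset.ne_of_mem_erase hwA))

lemma card_insert_erase (h : DualOn A c) {v w : E} (hv : v ∈ A) (hw : c v w ≠ 0) :
    (insert w (A.erase v)).card = A.card := by
  rw [Finset.card_insert_of_notMem (h.notMem_erase hv hw), Finset.card_erase_add_one hv]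

lemma exists_insert_erase (h : DualOn A c) {v w : E} (hv : v ∈ A) (hw : c v w ≠ 0) :
    ∃ c' : E → E →ᵃ[ℝ] ℝ, DualOn (insert w (A.erase v)) c' ∧
      ∀ x, c' w x = c v x / c v w := by
  have hwA := h.notMem_erase hv hw
  refine ⟨fun a => if a = w then (c v w)⁻¹ • c v else c a - (c a w / c v w) • c v,
    ⟨fun a ha => ?_, fun a ha b hb hab => ?_⟩, fun x => ?_⟩
  · rcases Finset.mem_insert.1 ha with rfl | ha'
    · simp [hw]
    · have haw : a ≠ w := fun e => hwA (e ▸ ha')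
      have := Finset.mem_erase.1 ha'
      simp [haw, h.apply_self a this.2, h.apply_ne v hv a this.2 this.1]
  · rcases Finset.mem_insert.1 ha with rfl | ha'
    · have := Finset.mem_erase.1 ((Finset.mem_insert.1 hb).resolve_left hab)
      simp [h.apply_ne v hv b this.2 this.1]
    · have haw : a ≠ w := fun e => hwA (e ▸ ha')
      have ha2 := Finset.mem_erase.1 ha'
      rcases Finset.mem_insert.1 hb with rfl | hb'
      · simp [haw, hw]
      · have := Finset.mem_erase.1 hb'
        simp [haw, h.apply_ne v hv b this.2 this.1, h.apply_ne a ha2.2 b this.2 hab]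
  · simp [div_eq_inv_mul]

omit [DecidableEq E] in
lemma notMem_convexHull_of_le (g : E →ᵃ[ℝ] ℝ) {s : Set E} {x : E}
    (hs : ∀ y ∈ s, g y ≤ 0) (hx : 0 < g x) : x ∉ convexHull ℝ s := fun hmem =>
  hx.not_ge (convexHull_min (t := g ⁻¹' Set.Iic 0) hs ((convex_Iic 0).affine_preimage g) hmem)

/-- A point with two positive barycentric coordinates and a negative one is in convex
position with respect to the simplex. -/
lemma notMem_convexHull_insert (h : DualOn A c) {w p q n : E} (hp : p ∈ A) (hq : q ∈ A)
    (hn : n ∈ A) (hpq : p ≠ q) (hpw : 0 < c p w) (hqw : 0 < c q w) (hnw : c n w < 0) :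
    ∀ x ∈ (↑(insert w A) : Set E), x ∉ convexHull ℝ ((↑(insert w A) : Set E) \ {x}) := by
  have positive_other : ∀ a ∈ A, ∃ b ∈ A, b ≠ a ∧ 0 < c b w := fun a _ => by
    by_cases hpa : p = a
    · exact ⟨q, hq, fun e => hpq (hpa.trans e.symm), hqw⟩
    · exact ⟨p, hp, hpa, hpw⟩
  intro x hx
  by_cases hxw : x = w
  · subst hxw
    refine notMem_convexHull_of_le (-c n) ?_ (by simpa using hnw)
    rintro y ⟨hy, hyx⟩
    have hyA : y ∈ A := (Finset.mem_insert.1 hy).resolve_left hyx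
    by_cases hyn : y = n
    · simp [hyn, h.apply_self n hn]
    · simp [h.apply_ne n hn y hyA hyn]
  · have hxA : x ∈ A := (Finset.mem_insert.1 hx).resolve_left hxw
    obtain ⟨b, hb, hbx, hbw⟩ := positive_other x hxA
    refine notMem_convexHull_of_le (c x - (|c x w| / c b w) • c b) ?_ ?_
    · rintro y ⟨hy, hyx⟩
      rcases Finset.mem_insert.1 hy with rfl | hyA
      · simp [div_mul_cancel₀ _ hbw.ne', le_abs_self]
      · by_cases hyb : y = b
        · subst hyb
          simp only [AffineMap.coe_sub, AffineMap.coe_smul, Pi.sub_apply, Pi.smul_apply,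
            smul_eq_mul, h.apply_ne x hxA y hb hyx, h.apply_self y hb]
          have : 0 ≤ |c x w| / c y w := by positivity
          linarith
        · simp [h.apply_ne x hxA y hyA hyx, h.apply_ne b hb y hyA hyb]
    · simp [h.apply_self x hxA, h.apply_ne b hb x hxA hbx.symm]

end DualOn

end AffineCoordinates

/-- A finite full-dimensional set of lattice points in convex position. -/
structure IsLatticeVertexSet (d : ℕ) (T : Finset (Pt d)) : Prop where
  span : affineSpan ℝ (T : Set (Pt d)) = ⊤
  lattice : ∀ x ∈ T, IsLatticePt d x
  notMem : ∀ x ∈ (T : Set (Pt d)), x ∉ convexHull ℝ ((T : Set (Pt d)) \ {x})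

/-- The vertex set of a full-dimensional lattice simplex. -/
structure IsLatticeSimplex (d : ℕ) (A : Finset (Pt d)) : Prop where
  card : A.card = d + 1
  lattice : ∀ x ∈ A, IsLatticePt d x
  dual : ∃ c, DualOn A c

lemma convexHull_extremePoints_eq {d : ℕ} (S : Finset (Pt d)) :
    convexHull ℝ (Set.extremePoints ℝ (convexHull ℝ (S : Set (Pt d)))) =
      convexHull ℝ (S : Set (Pt d)) := by
  have hfin : (Set.extremePoints ℝ (convexHull ℝ (S : Set (Pt d)))).Finite :=
    S.finite_toSet.subset extremePoints_convexHull_subset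
  conv_rhs => rw [← closure_convexHull_extremePoints (S.finite_toSet.isCompact_convexHull ℝ)
    (convex_convexHull ℝ _)]
  exact (hfin.isClosed_convexHull ℝ).closure_eq.symm

namespace IsLatticeVertexSet

variable {d : ℕ} {T U : Finset (Pt d)}

lemma extremePoints (hT : IsLatticeVertexSet d T) :
    Set.extremePoints ℝ (convexHull ℝ (T : Set (Pt d))) = T := by
  refine extremePoints_convexHull_subset.antisymm fun x hx => ?_
  by_contra hxe
  refine hT.notMem x hx ?_
  have hmem : x ∈ convexHull ℝ (T : Set (Pt d)) := subset_convexHull ℝ _ hx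
  rw [← convexHull_extremePoints_eq] at hmem
  exact convexHull_mono (Set.subset_sdiff_singleton extremePoints_convexHull_subset hxe) hmem

lemma nVerts (hT : IsLatticeVertexSet d T) : nVerts d (convexHull ℝ (T : Set (Pt d))) = T.card := by
  rw [_root_.nVerts, hT.extremePoints, Set.ncard_coe_finset]

lemma mem_Lambda (hT : IsLatticeVertexSet d T) : convexHull ℝ (T : Set (Pt d)) ∈ Lambda d :=
  ⟨⟨T, rfl⟩, by rw [FullDim, affineSpan_convexHull, hT.span], fun v hv =>
    hT.lattice v (extremePoints_convexHull_subset hv)⟩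

lemma of_subset (hT : IsLatticeVertexSet d T) (hUT : U ⊆ T)
    (hU : affineSpan ℝ (U : Set (Pt d)) = ⊤) : IsLatticeVertexSet d U :=
  ⟨hU, fun x hx => hT.lattice x (hUT hx), fun x hx h => hT.notMem x (hUT hx)
    (convexHull_mono (Set.sdiff_subset_sdiff_left (Finset.coe_subset.2 hUT)) h)⟩

lemma insertMove {x : Pt d} (hT : IsLatticeVertexSet d T)
    (hx : IsLatticeVertexSet d (insert x T)) :
    InsertMove d (convexHull ℝ (T : Set (Pt d))) (convexHull ℝ (↑(insert x T) : Set (Pt d))) := by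
  have hhull : convexHull ℝ (convexHull ℝ (T : Set (Pt d)) ∪ {x}) =
      convexHull ℝ (↑(insert x T) : Set (Pt d)) := by
    rw [convexHull_convexHull_union_left, Finset.coe_insert, Set.union_singleton]
  refine ⟨x, ?_, hhull.symm⟩
  rw [CanInsert, hhull, hx.extremePoints, hT.extremePoints, Finset.coe_insert,
    Set.union_singleton]

end IsLatticeVertexSet

namespace IsLatticeSimplex

variable {d : ℕ} {A : Finset (Pt d)} {c : Pt d → Pt d →ᵃ[ℝ] ℝ}

lemma span (hA : IsLatticeSimplex d A) : affineSpan ℝ (A : Set (Pt d)) = ⊤ := by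
  obtain ⟨c, hc⟩ := hA.dual
  have := hc.affineIndependent.affineSpan_eq_top_iff_card_eq_finrank_add_one.2
    (by simp [hA.card])
  simpa using this

lemma insert_erase (hA : IsLatticeSimplex d A) (hc : DualOn A c) {v w : Pt d} (hv : v ∈ A)
    (hw : IsLatticePt d w) (hvw : c v w ≠ 0) : IsLatticeSimplex d (insert w (A.erase v)) := by
  obtain ⟨c', hc', -⟩ := hc.exists_insert_erase hv hvw
  refine ⟨(hc.card_insert_erase hv hvw).trans hA.card, fun x hx => ?_, c', hc'⟩
  rcases Finset.mem_insert.1 hx with rfl | hx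
  · exact hw
  · exact hA.lattice x (Finset.mem_of_mem_erase hx)

end IsLatticeSimplex

/-- Some full-dimensional lattice simplex is spanned by points of a spanning lattice set. -/
lemma exists_isLatticeSimplex_subset {d : ℕ} {T : Finset (Pt d)}
    (hT : affineSpan ℝ (T : Set (Pt d)) = ⊤) (hlat : ∀ x ∈ T, IsLatticePt d x) :
    ∃ A ⊆ T, IsLatticeSimplex d A := by
  obtain ⟨s, hs, b, hb⟩ := AffineBasis.exists_affine_subbasis hT
  have hfin : s.Finite := T.finite_toSet.subset hs
  lift s to Finset (Pt d) using hfin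
  refine ⟨s, Finset.coe_subset.1 hs, ?_, fun x hx => hlat x (hs hx), ?_⟩
  · have := b.ind.affineSpan_eq_top_iff_card_eq_finrank_add_one.1 b.tot
    simpa using this
  · refine ⟨fun a => if h : a ∈ (s : Set (Pt d)) then b.coord ⟨a, h⟩ else 0, ?_, ?_⟩
    · intro a ha
      have := b.coord_apply_eq ⟨a, ha⟩
      rw [hb] at this
      simpa [ha] using this
    · intro a ha a' ha' hne
      have := b.coord_apply_ne (i := ⟨a, ha⟩) (j := ⟨a', ha'⟩) (by simpa using hne.symm)
      rw [hb] at this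
      simpa [ha] using this

lemma exists_isLatticeVertexSet {d : ℕ} {P : Set (Pt d)} (hP : P ∈ Lambda d) :
    ∃ T : Finset (Pt d), IsLatticeVertexSet d T ∧ P = convexHull ℝ (T : Set (Pt d)) := by
  obtain ⟨⟨S, rfl⟩, hfull, hlat⟩ := hP
  have hfin : (Set.extremePoints ℝ (convexHull ℝ (S : Set (Pt d)))).Finite :=
    S.finite_toSet.subset extremePoints_convexHull_subset
  refine ⟨hfin.toFinset, ⟨?_, fun x hx => hlat x (by simpa using hx), ?_⟩, ?_⟩
  · rw [hfin.coe_toFinset, ← affineSpan_convexHull, convexHull_extremePoints_eq]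
    exact hfull
  · rw [hfin.coe_toFinset]
    exact convexIndependent_set_iff_notMem_convexHull_sdiff.1
      (convex_convexHull ℝ _).convexIndependent_extremePoints
  · rw [hfin.coe_toFinset, convexHull_extremePoints_eq]

lemma Move.symm {d : ℕ} {P Q : Set (Pt d)} (h : Move d P Q) : Move d Q P := by
  unfold Move at *
  tauto

/-- Reachability by moves in the subgraph induced by the class `C`. -/
def Reach (d : ℕ) (C : Set (Set (Pt d))) : Set (Pt d) → Set (Pt d) → Prop :=
  Relation.ReflTransGen fun P Q => P ∈ C ∧ Q ∈ C ∧ Move d P Q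

namespace Reach

variable {d : ℕ} {C : Set (Set (Pt d))} {P Q S : Set (Pt d)}

lemma symm (h : Reach d C P Q) : Reach d C Q P := by
  have : Std.Symm fun P Q => P ∈ C ∧ Q ∈ C ∧ Move d P Q :=
    ⟨fun _ _ h => ⟨h.2.1, h.1, h.2.2.symm⟩⟩
  exact Relation.ReflTransGen.stdSymm.symm _ _ h

lemma trans (h : Reach d C P Q) (h' : Reach d C Q S) : Reach d C P S :=
  Relation.ReflTransGen.trans h h'

lemma exists_pathLE (hP : P ∈ C) (h : Reach d C P Q) : ∃ n, PathLE d C P Q n := by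
  induction h with
  | refl => exact ⟨0, 0, fun _ => P, le_rfl, rfl, rfl, fun _ _ => hP, fun i hi => by omega⟩
  | @tail Q S _ hQS ih =>
    obtain ⟨n, m, f, -, h0, hm, hC, hmove⟩ := ih
    refine ⟨m + 1, m + 1, fun i => if i ≤ m then f i else S, le_rfl, by simpa using h0,
      by simp, fun i _ => ?_, fun i hi => ?_⟩
    · by_cases him : i ≤ m
      · simpa [him] using hC i him
      · simpa [him] using hQS.2.1
    · by_cases him : i < m
      · simpa [him, him.le, Nat.succ_le_iff] using hmove i him
      · have : i = m := by omega
        subst this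
        simpa [hm] using hQS.2.2

end Reach

/-- The full-dimensional lattice polytopes whose number of vertices satisfies `R`. -/
def latticeClass (d : ℕ) (R : ℕ → Prop) : Set (Set (Pt d)) := {P ∈ Lambda d | R (nVerts d P)}

section Connectivity

variable {d : ℕ} {R : ℕ → Prop}

lemma IsLatticeVertexSet.mem_latticeClass {T : Finset (Pt d)} (hT : IsLatticeVertexSet d T)
    (hR : R T.card) : convexHull ℝ (T : Set (Pt d)) ∈ latticeClass d R :=
  ⟨hT.mem_Lambda, by rwa [hT.nVerts]⟩

lemma reach_insert {T : Finset (Pt d)} {x : Pt d}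
    (hT : IsLatticeVertexSet d T) (hx : IsLatticeVertexSet d (insert x T))
    (hRT : R T.card) (hRx : R (insert x T).card) :
    Reach d (latticeClass d R) (convexHull ℝ (T : Set (Pt d)))
      (convexHull ℝ (↑(insert x T) : Set (Pt d))) :=
  .single ⟨hT.mem_latticeClass hRT, hx.mem_latticeClass hRx, Or.inl (hT.insertMove hx)⟩

/-- Deleting vertices one at a time leads to any simplex spanned by vertices. -/
lemma reach_of_subset (hR : ∀ m n, d + 1 ≤ m → m ≤ n → R n → R m) {A T : Finset (Pt d)}
    (hA : IsLatticeSimplex d A) (hT : IsLatticeVertexSet d T) (hAT : A ⊆ T) (hRT : R T.card) :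
    Reach d (latticeClass d R) (convexHull ℝ (A : Set (Pt d)))
      (convexHull ℝ (T : Set (Pt d))) := by
  have between : ∀ U : Finset (Pt d), A ⊆ U → U ⊆ T → IsLatticeVertexSet d U ∧ R U.card :=
    fun U hAU hUT => ⟨hT.of_subset hUT (top_unique (hA.span ▸ affineSpan_mono ℝ hAU)),
      hR _ _ (hA.card ▸ Finset.card_le_card hAU) (Finset.card_le_card hUT) hRT⟩
  have key : ∀ U ⊆ T, Reach d (latticeClass d R) (convexHull ℝ (A : Set (Pt d)))
      (convexHull ℝ (↑(U ∪ A) : Set (Pt d))) := by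
    intro U
    induction U using Finset.induction_on with
    | empty => intro _; rw [Finset.empty_union]; exact .refl
    | insert x U _ ih =>
      intro hU
      have hUT := (Finset.subset_insert x U).trans hU
      have h1 := between (U ∪ A) Finset.subset_union_right (Finset.union_subset hUT hAT)
      have h2 := between (insert x U ∪ A) Finset.subset_union_right (Finset.union_subset hU hAT)
      rw [Finset.insert_union] at h2 ⊢
      exact (ih hUT).trans (reach_insert h1.1 h2.1 h1.2 h2.2)
  simpa [Finset.union_eq_left.2 hAT] using key T subset_rfl

variable (hR : ∀ m n, d + 1 ≤ m → m ≤ n → R n → R m) (hR2 : R (d + 2))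
include hR hR2

/-- A vertex of a simplex may be exchanged for a lattice point with two positive barycentric
coordinates and a negative one. -/
lemma reach_flip {A : Finset (Pt d)} {c : Pt d → Pt d →ᵃ[ℝ] ℝ} (hA : IsLatticeSimplex d A)
    (hc : DualOn A c) {v w p q n : Pt d} (hv : v ∈ A) (hw : IsLatticePt d w) (hvw : c v w ≠ 0)
    (hp : p ∈ A) (hq : q ∈ A) (hn : n ∈ A) (hpq : p ≠ q) (hpw : 0 < c p w) (hqw : 0 < c q w)
    (hnw : c n w < 0) :
    Reach d (latticeClass d R) (convexHull ℝ (A : Set (Pt d)))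
      (convexHull ℝ (↑(insert w (A.erase v)) : Set (Pt d))) := by
  have hT : IsLatticeVertexSet d (insert w A) := by
    refine ⟨top_unique (hA.span ▸ affineSpan_mono ℝ (by simp)), fun x hx => ?_,
      hc.notMem_convexHull_insert hp hq hn hpq hpw hqw hnw⟩
    rcases Finset.mem_insert.1 hx with rfl | hx
    · exact hw
    · exact hA.lattice x hx
  have hRT : R (insert w A).card :=
    hR _ (d + 2) (hA.card ▸ Finset.card_le_card (Finset.subset_insert w A))
      ((Finset.card_insert_le w A).trans (by rw [hA.card])) hR2
  exact (reach_of_subset hR hA hT (Finset.subset_insert w A) hRT).trans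
    (reach_of_subset hR (hA.insert_erase hc hv hw hvw) hT
      (Finset.insert_subset_insert w (Finset.erase_subset v A)) hRT).symm

omit hR hR2 in
lemma exists_pair_mem_erase (hd : 2 ≤ d) {A : Finset (Pt d)} (hA : IsLatticeSimplex d A)
    {v : Pt d} (hv : v ∈ A) : ∃ f₁ ∈ A, ∃ f₂ ∈ A, f₁ ≠ v ∧ f₂ ≠ v ∧ f₁ ≠ f₂ := by
  have hcard : 1 < (A.erase v).card := by
    rw [Finset.card_erase_of_mem hv, hA.card]
    omega
  obtain ⟨f₁, h₁, f₂, h₂, hne⟩ := Finset.one_lt_card.1 hcard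
  rw [Finset.mem_erase] at h₁ h₂
  exact ⟨f₁, h₁.2, f₂, h₂.2, h₁.1, h₂.1, hne⟩

/-- A vertex of a simplex may be moved within its side of the opposite facet: both positions
may be exchanged for a common point far away along an edge of that facet. -/
lemma reach_of_pos (hd : 2 ≤ d) {A : Finset (Pt d)} {c : Pt d → Pt d →ᵃ[ℝ] ℝ}
    (hA : IsLatticeSimplex d A) (hc : DualOn A c) {v x : Pt d} (hv : v ∈ A)
    (hx : IsLatticePt d x) (hvx : 0 < c v x) :
    Reach d (latticeClass d R) (convexHull ℝ (A : Set (Pt d)))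
      (convexHull ℝ (↑(insert x (A.erase v)) : Set (Pt d))) := by
  obtain ⟨f₁, hf₁, f₂, hf₂, h₁, h₂, hne⟩ := exists_pair_mem_erase hd hA hv
  have hA' := hA.insert_erase hc hv hx hvx.ne'
  have hxA := hc.notMem_erase hv hvx.ne'
  obtain ⟨c', hc', hc'x⟩ := hc.exists_insert_erase hv hvx.ne'
  have hf₁' : f₁ ∈ insert x (A.erase v) := by simp [hf₁, h₁]
  have hf₂' : f₂ ∈ insert x (A.erase v) := by simp [hf₂, h₂]
  have hx' : x ∈ insert x (A.erase v) := Finset.mem_insert_self _ _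
  have hf₁x : f₁ ≠ x := fun e => hxA (by simp [← e, hf₁, h₁])
  have hf₂x : f₂ ≠ x := fun e => hxA (by simp [← e, hf₂, h₂])
  obtain ⟨N, hN⟩ := exists_nat_gt (|c' f₁ v| + |c' f₂ v|)
  have hN0 : (0 : ℝ) < N := lt_of_le_of_lt (by positivity) hN
  set w : Pt d := v + (N : ℝ) • (f₁ - f₂) with hwdef
  have hw : IsLatticePt d w := by
    intro i
    obtain ⟨a, ha⟩ := hA.lattice v hv i
    obtain ⟨b, hb⟩ := hA.lattice f₁ hf₁ i
    obtain ⟨e, he⟩ := hA.lattice f₂ hf₂ i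
    exact ⟨a + N * (b - e), by simp [hwdef, ha, hb, he]⟩
  have hvw : c v w = 1 := by
    rw [AffineMap.apply_add_smul_sub, hc.apply_self v hv, hc.apply_ne v hv f₁ hf₁ h₁,
      hc.apply_ne v hv f₂ hf₂ h₂]
    ring
  have hf₁w : c f₁ w = N := by
    rw [AffineMap.apply_add_smul_sub, hc.apply_self f₁ hf₁, hc.apply_ne f₁ hf₁ v hv h₁.symm,
      hc.apply_ne f₁ hf₁ f₂ hf₂ hne.symm]
    ring
  have hf₂w : c f₂ w = -N := by
    rw [AffineMap.apply_add_smul_sub, hc.apply_self f₂ hf₂, hc.apply_ne f₂ hf₂ v hv h₂.symm,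
      hc.apply_ne f₂ hf₂ f₁ hf₁ hne]
    ring
  have hxw : 0 < c' x w := by
    rw [hc'x, hvw]
    positivity
  have hf₁w' : 0 < c' f₁ w := by
    rw [AffineMap.apply_add_smul_sub, hc'.apply_self f₁ hf₁',
      hc'.apply_ne f₁ hf₁' f₂ hf₂' hne.symm]
    linarith [neg_abs_le (c' f₁ v), abs_nonneg (c' f₂ v)]
  have hf₂w' : c' f₂ w < 0 := by
    rw [AffineMap.apply_add_smul_sub, hc'.apply_self f₂ hf₂', hc'.apply_ne f₂ hf₂' f₁ hf₁' hne]
    linarith [le_abs_self (c' f₂ v), abs_nonneg (c' f₁ v)]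
  have hfrom_A := reach_flip hR hR2 hA hc hv hw (by rw [hvw]; exact one_ne_zero) hv hf₁ hf₂ h₁.symm
    (by rw [hvw]; exact one_pos) (by rwa [hf₁w]) (by rw [hf₂w]; linarith)
  have hfrom_A' := reach_flip hR hR2 hA' hc' hx' hw hxw.ne' hx' hf₁' hf₂' hf₁x.symm hxw hf₁w' hf₂w'
  rw [Finset.erase_insert hxA] at hfrom_A'
  exact hfrom_A.trans hfrom_A'.symm

/-- A vertex of a simplex may be moved to any lattice point off the opposite facet. -/
lemma reach_of_ne_zero (hd : 2 ≤ d) {A : Finset (Pt d)} {c : Pt d → Pt d →ᵃ[ℝ] ℝ}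
    (hA : IsLatticeSimplex d A) (hc : DualOn A c) {v x : Pt d} (hv : v ∈ A)
    (hx : IsLatticePt d x) (hvx : c v x ≠ 0) :
    Reach d (latticeClass d R) (convexHull ℝ (A : Set (Pt d)))
      (convexHull ℝ (↑(insert x (A.erase v)) : Set (Pt d))) := by
  rcases hvx.lt_or_gt with hneg | hpos
  swap
  · exact reach_of_pos hR hR2 hd hA hc hv hx hpos
  obtain ⟨f₁, hf₁, f₂, hf₂, h₁, h₂, hne⟩ := exists_pair_mem_erase hd hA hv
  set y : Pt d := f₁ + f₂ - v with hydef
  have hy : IsLatticePt d y := by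
    intro i
    obtain ⟨a, ha⟩ := hA.lattice v hv i
    obtain ⟨b, hb⟩ := hA.lattice f₁ hf₁ i
    obtain ⟨e, he⟩ := hA.lattice f₂ hf₂ i
    exact ⟨b + e - a, by simp [hydef, ha, hb, he]⟩
  have hvy : c v y = -1 := by
    rw [AffineMap.apply_add_sub, hc.apply_self v hv, hc.apply_ne v hv f₁ hf₁ h₁,
      hc.apply_ne v hv f₂ hf₂ h₂]
    ring
  have hf₁y : c f₁ y = 1 := by
    rw [AffineMap.apply_add_sub, hc.apply_self f₁ hf₁, hc.apply_ne f₁ hf₁ v hv h₁.symm,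
      hc.apply_ne f₁ hf₁ f₂ hf₂ hne.symm]
    ring
  have hf₂y : c f₂ y = 1 := by
    rw [AffineMap.apply_add_sub, hc.apply_self f₂ hf₂, hc.apply_ne f₂ hf₂ v hv h₂.symm,
      hc.apply_ne f₂ hf₂ f₁ hf₁ hne]
    ring
  have hvy0 : c v y ≠ 0 := by
    rw [hvy]
    norm_num
  obtain ⟨c', hc', hc'y⟩ := hc.exists_insert_erase hv hvy0
  have hfrom_A := reach_flip hR hR2 hA hc hv hy hvy0 hf₁ hf₂ hv hne (by rw [hf₁y]; exact one_pos)
    (by rw [hf₂y]; exact one_pos) (by rw [hvy]; norm_num)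
  have hto := reach_of_pos hR hR2 hd (hA.insert_erase hc hv hy hvy0) hc'
    (Finset.mem_insert_self y _) hx (by rw [hc'y, hvy]; linarith)
  rw [Finset.erase_insert (hc.notMem_erase hv hvy0)] at hto
  exact hfrom_A.trans hto

omit hR hR2 in
lemma exists_exchange {A B : Finset (Pt d)} {c : Pt d → Pt d →ᵃ[ℝ] ℝ}
    (hA : IsLatticeSimplex d A) (hc : DualOn A c) (hB : IsLatticeSimplex d B) {b : Pt d}
    (hb : b ∈ B) (hbA : b ∉ A) : ∃ a ∈ A, a ∉ B ∧ c a b ≠ 0 := by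
  by_contra! h
  obtain ⟨c', hc'⟩ := hB.dual
  have hsum := hc.apply_eq_sum hA.span (c' b) b
  rw [hc'.apply_self b hb, Finset.sum_eq_zero] at hsum
  · exact one_ne_zero hsum
  · intro a ha
    by_cases haB : a ∈ B
    · rw [hc'.apply_ne b hb a haB (fun e => hbA (e ▸ ha)), zero_mul]
    · rw [h a ha haB, mul_zero]

lemma reach_simplex (hd : 2 ≤ d) {A B : Finset (Pt d)} (hA : IsLatticeSimplex d A)
    (hB : IsLatticeSimplex d B) :
    Reach d (latticeClass d R) (convexHull ℝ (A : Set (Pt d)))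
      (convexHull ℝ (B : Set (Pt d))) := by
  induction hk : (B \ A).card generalizing A with
  | zero =>
    have hBA : B ⊆ A := Finset.sdiff_eq_empty_iff_subset.1 (Finset.card_eq_zero.1 hk)
    rw [Finset.eq_of_subset_of_card_le hBA (by rw [hA.card, hB.card])]
    exact .refl
  | succ k ih =>
    obtain ⟨b, hb⟩ := Finset.card_pos.1 (k.succ_pos.trans_eq hk.symm)
    obtain ⟨hbB, hbA⟩ := Finset.mem_sdiff.1 hb
    obtain ⟨c, hc⟩ := hA.dual
    obtain ⟨a, ha, haB, hab⟩ := exists_exchange hA hc hB hbB hbA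
    have hbl := hB.lattice b hbB
    refine (reach_of_ne_zero hR hR2 hd hA hc ha hbl hab).trans
      (ih (hA.insert_erase hc ha hbl hab) ?_)
    have hdiff : B \ insert b (A.erase a) = (B \ A).erase b := by
      ext z
      simp only [Finset.mem_sdiff, Finset.mem_insert, Finset.mem_erase]
      constructor
      · rintro ⟨hzB, hz⟩
        exact ⟨fun e => hz (.inl e), hzB,
          fun hzA => hz (.inr ⟨fun e => haB (e ▸ hzB), hzA⟩)⟩
      · rintro ⟨hzb, hzB, hzA⟩
        exact ⟨hzB, fun hz => hz.elim hzb fun h => hzA h.2⟩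
    rw [hdiff, Finset.card_erase_of_mem hb, hk, Nat.add_sub_cancel]

lemma connectedIn_latticeClass (hd : 2 ≤ d) : ConnectedIn d (latticeClass d R) := by
  have to_simplex : ∀ P ∈ latticeClass d R, ∃ A, IsLatticeSimplex d A ∧
      Reach d (latticeClass d R) (convexHull ℝ (A : Set (Pt d))) P := by
    rintro P ⟨hP, hRP⟩
    obtain ⟨T, hT, rfl⟩ := exists_isLatticeVertexSet hP
    obtain ⟨A, hAT, hA⟩ := exists_isLatticeSimplex_subset hT.span hT.lattice
    exact ⟨A, hA, reach_of_subset hR hA hT hAT (hT.nVerts ▸ hRP)⟩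
  intro P hP Q hQ
  obtain ⟨A, hA, hAP⟩ := to_simplex P hP
  obtain ⟨B, hB, hBQ⟩ := to_simplex Q hQ
  exact (hAP.symm.trans ((reach_simplex hR hR2 hd hA hB).trans hBQ)).exists_pathLE hP

end Connectivity

/-- the graph `Λ(d)` is connected, and so is its subgraph induced by
the lattice simplices and the lattice polytopes with `d + 2` vertices. -/
theorem stmt_13 (d : ℕ) (hd : 2 ≤ d) :
    ConnectedIn d (Lambda d) ∧
    ConnectedIn d {P ∈ Lambda d | nVerts d P = d + 1 ∨ nVerts d P = d + 2} := by
  refine ⟨?_, connectedIn_latticeClass (R := fun n => n = d + 1 ∨ n = d + 2)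
    (fun m n _ _ _ => by omega) (.inr rfl) hd⟩
  simpa [latticeClass] using
    connectedIn_latticeClass (d := d) (R := fun _ => True) (by simp) trivial hd
end
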